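/- Under assumptions (i)–(ii), the function h(ξ, y) = E[L(ξ, −⟨y, X⟩)] − Σ_i b_i log y_i is continuously differentiable on ℝ × (0,∞)^d with ∂_ξ h(ξ,y) = E[∂_ξ L(ξ, −⟨y,X⟩)] and ∂_{y_i} h(ξ,y) = E[−X_i ∂_x L(ξ, −⟨y,X⟩)] − b_i/y_i for each i, and the set of minimizers of h equals {z ∈ ℝ × (0,∞)^d : ∇h(z) = 0}. Moreover, if for every y ∈ (0,∞)^d the minimum min_{ξ∈ℝ} E[L(ξ, −⟨y,X⟩)] is attained at a unique point ξ*(y) and equals g(r(y)), then for any minimizer (ξ°, y°) of h, y° is the unique minimizer of Γ_g, so that u° = y°/‖y°‖₁ satisfies the risk-budgeting equations u°_i ∂_{u_i} r(u°) = b_i r(u°) for all i. -/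

import Mathlib

open scoped BigOperators Classical
open Set MeasureTheory

noncomputable section

/-- A convex function on `ℝ × ℝ` with both partial derivatives at a point is Fréchet
differentiable there. -/
theorem ConvexOn.hasFDerivAt_of_hasDerivAt_prod {f : ℝ × ℝ → ℝ} (hf : ConvexOn ℝ Set.univ f)
    {x s a c : ℝ} (h₁ : HasDerivAt (fun t => f (t, s)) a x)
    (h₂ : HasDerivAt (fun t => f (x, t)) c s) :
    HasFDerivAt f (a • ContinuousLinearMap.fst ℝ ℝ ℝ + c • ContinuousLinearMap.snd ℝ ℝ ℝ)
      (x, s) := by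
  set R : ℝ × ℝ → ℝ := fun p => f ((x, s) + p) - f (x, s) - (a * p.1 + c * p.2) with hR
  set E : ℝ × ℝ → ℝ := fun p =>
    (1 / 2) * (f (x + 2 * p.1, s) - f (x, s) - (2 * p.1) * a) +
    (1 / 2) * (f (x, s + 2 * p.2) - f (x, s) - (2 * p.2) * c) with hE
  have hEo : E =o[nhds 0] fun p : ℝ × ℝ => p := by
    have k₁ := hasDerivAt_iff_isLittleO_nhds_zero.1 h₁
    have k₂ := hasDerivAt_iff_isLittleO_nhds_zero.1 h₂
    have t₁ : Filter.Tendsto (fun p : ℝ × ℝ => 2 * p.1) (nhds 0) (nhds 0) := by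
      have : Continuous (fun p : ℝ × ℝ => 2 * p.1) := by fun_prop
      simpa using this.tendsto 0
    have t₂ : Filter.Tendsto (fun p : ℝ × ℝ => 2 * p.2) (nhds 0) (nhds 0) := by
      have : Continuous (fun p : ℝ × ℝ => 2 * p.2) := by fun_prop
      simpa using this.tendsto 0
    have o₁ : (fun p : ℝ × ℝ => 2 * p.1) =O[nhds 0] fun p : ℝ × ℝ => p :=
      (ContinuousLinearMap.isBigO_id (ContinuousLinearMap.fst ℝ ℝ ℝ) _).const_mul_left 2
    have o₂ : (fun p : ℝ × ℝ => 2 * p.2) =O[nhds 0] fun p : ℝ × ℝ => p :=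
      (ContinuousLinearMap.isBigO_id (ContinuousLinearMap.snd ℝ ℝ ℝ) _).const_mul_left 2
    have e₁ := ((k₁.comp_tendsto t₁).trans_isBigO o₁).const_mul_left (1 / 2)
    have e₂ := ((k₂.comp_tendsto t₂).trans_isBigO o₂).const_mul_left (1 / 2)
    simpa [Function.comp_def, hE] using e₁.add e₂
  have hEneg : (fun p => E (-p)) =o[nhds 0] fun p : ℝ × ℝ => p := by
    have t : Filter.Tendsto (fun p : ℝ × ℝ => -p) (nhds 0) (nhds 0) := by
      simpa using (continuous_neg (G := ℝ × ℝ)).tendsto 0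
    exact (hEo.comp_tendsto t).neg_right.congr (fun _ => rfl) (fun _ => by simp)
  have hRE : ∀ p, R p ≤ E p := by
    intro p
    have := hf.2 (Set.mem_univ (x + 2 * p.1, s)) (Set.mem_univ (x, s + 2 * p.2))
      (by norm_num : (0 : ℝ) ≤ 1 / 2) (by norm_num : (0 : ℝ) ≤ 1 / 2) (by norm_num)
    have e : (1 / 2 : ℝ) • (x + 2 * p.1, s) + (1 / 2 : ℝ) • (x, s + 2 * p.2) = (x, s) + p := by
      ext <;> simp <;> ring
    rw [e] at this
    simp only [smul_eq_mul] at this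
    simp only [hR, hE]
    linarith
  have hRneg : ∀ p, -R p ≤ E (-p) := by
    intro p
    have k := hRE (-p)
    have := hf.2 (Set.mem_univ ((x, s) + p)) (Set.mem_univ ((x, s) + -p))
      (by norm_num : (0 : ℝ) ≤ 1 / 2) (by norm_num : (0 : ℝ) ≤ 1 / 2) (by norm_num)
    have e : (1 / 2 : ℝ) • ((x, s) + p) + (1 / 2 : ℝ) • ((x, s) + -p) = (x, s) := by
      ext <;> simp <;> ring
    rw [e] at this
    simp only [smul_eq_mul] at this
    simp only [hR, Prod.fst_neg, Prod.snd_neg] at k ⊢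
    linarith
  have hRo : R =o[nhds 0] fun p : ℝ × ℝ => p := by
    refine Asymptotics.IsBigO.trans_isLittleO ?_ (hEo.abs_left.add hEneg.abs_left)
    refine Asymptotics.isBigO_of_le _ fun p => ?_
    rw [Real.norm_eq_abs, Real.norm_eq_abs]
    refine (abs_le'.2 ⟨?_, ?_⟩).trans (le_abs_self _)
    · linarith [hRE p, le_abs_self (E p), abs_nonneg (E (-p))]
    · linarith [hRneg p, le_abs_self (E (-p)), abs_nonneg (E p)]
  rw [hasFDerivAt_iff_isLittleO_nhds_zero]
  simpa [hR] using hRo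

/-- A critical point of a differentiable convex function is a minimizer. -/
theorem ConvexOn.isMinOn_of_hasFDerivAt_zero {E : Type*} [NormedAddCommGroup E] [NormedSpace ℝ E]
    {s : Set E} {f : E → ℝ} (hf : ConvexOn ℝ s f) {x : E} (hx : x ∈ s)
    (hfx : HasFDerivAt f (0 : E →L[ℝ] ℝ) x) : IsMinOn f s x := by
  refine isMinOn_iff.2 fun w hw => ?_
  have hc : ConvexOn ℝ (Icc (0 : ℝ) 1) (f ∘ AffineMap.lineMap x w) := by
    refine (hf.comp_affineMap (AffineMap.lineMap x w)).subset ?_ (convex_Icc 0 1)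
    intro t ht
    exact hf.1.lineMap_mem hx hw ht
  have hd : HasDerivAt (f ∘ (AffineMap.lineMap x w : ℝ → E)) 0 0 := by
    have hl : HasDerivAt (AffineMap.lineMap x w : ℝ → E) (w - x) 0 := AffineMap.hasDerivAt_lineMap
    have hfx' : HasFDerivAt f (0 : E →L[ℝ] ℝ) ((AffineMap.lineMap x w : ℝ → E) 0) := by
      simpa using hfx
    simpa using hfx'.comp_hasDerivAt 0 hl
  have := hc.le_slope_of_hasDerivAt (by simp) (by simp) zero_lt_one hd
  simp [slope_def_field] at this
  exact this

theorem isOpen_setOf_forall_pos (d : ℕ) : IsOpen {y : Fin d → ℝ | ∀ i, 0 < y i} := by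
  have : {y : Fin d → ℝ | ∀ i, 0 < y i} = ⋂ i, {y | 0 < y i} := by ext; simp
  rw [this]
  exact isOpen_iInter_of_finite fun i => isOpen_lt continuous_const (continuous_apply i)

theorem convex_setOf_forall_pos (d : ℕ) : Convex ℝ {y : Fin d → ℝ | ∀ i, 0 < y i} := by
  have : {y : Fin d → ℝ | ∀ i, 0 < y i} = Set.univ.pi fun _ => Ioi 0 := by ext; simp
  rw [this]
  exact convex_pi fun _ _ => convex_Ioi 0

/-- The logarithmic barrier with positive weights is strictly convex on the open orthant. -/
theorem strictConvexOn_neg_sum_mul_log {d : ℕ} {b : Fin d → ℝ} (hb : ∀ i, 0 < b i) :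
    StrictConvexOn ℝ {y : Fin d → ℝ | ∀ i, 0 < y i} (fun y => -∑ i, b i * Real.log (y i)) := by
  refine ⟨convex_setOf_forall_pos d, fun x hx y hy hxy α β hα hβ hαβ => ?_⟩
  have key : ∑ i, (α * (b i * Real.log (x i)) + β * (b i * Real.log (y i))) <
      ∑ i, b i * Real.log ((α • x + β • y) i) := by
    obtain ⟨j, hj⟩ := Function.ne_iff.1 hxy
    refine Finset.sum_lt_sum (fun i _ => ?_) ⟨j, Finset.mem_univ j, ?_⟩
    · have := strictConcaveOn_log_Ioi.concaveOn.2 (hx i) (hy i) hα.le hβ.le hαβ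
      simp only [smul_eq_mul, Pi.add_apply, Pi.smul_apply] at this ⊢
      nlinarith [hb i]
    · have := strictConcaveOn_log_Ioi.2 (hx j) (hy j) hj hα hβ hαβ
      simp only [smul_eq_mul, Pi.add_apply, Pi.smul_apply] at this ⊢
      nlinarith [hb j]
  rw [Finset.sum_add_distrib, ← Finset.mul_sum, ← Finset.mul_sum] at key
  simp only [smul_eq_mul]
  linarith

theorem hasFDerivAt_sum_mul_log {d : ℕ} (b : Fin d → ℝ) {y : Fin d → ℝ} (hy : ∀ i, 0 < y i) :
    HasFDerivAt (fun y : Fin d → ℝ => ∑ i, b i * Real.log (y i))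
      (∑ i, (b i / y i) • (ContinuousLinearMap.proj i : (Fin d → ℝ) →L[ℝ] ℝ)) y := by
  refine HasFDerivAt.fun_sum fun i _ => ?_
  have := ((hasFDerivAt_apply (𝕜 := ℝ) i y).log (hy i).ne').const_mul (b i)
  rwa [smul_smul, ← div_eq_mul_inv] at this

section Integrand

variable {d : ℕ} {L Lξ Lx : ℝ → ℝ → ℝ}

/-- The chain rule for `(ξ, y) ↦ L ξ (-⟨y, v⟩)`. -/
theorem hasFDerivAt_neg_inner (hL : ConvexOn ℝ Set.univ (fun p : ℝ × ℝ => L p.1 p.2))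
    (v : Fin d → ℝ) (z : ℝ × (Fin d → ℝ)) {a c : ℝ}
    (h₁ : HasDerivAt (fun t => L t (-(∑ i, z.2 i * v i))) a z.1)
    (h₂ : HasDerivAt (fun x => L z.1 x) c (-(∑ i, z.2 i * v i))) :
    HasFDerivAt (fun z : ℝ × (Fin d → ℝ) => L z.1 (-(∑ i, z.2 i * v i)))
      (a • ContinuousLinearMap.fst ℝ ℝ (Fin d → ℝ) +
        ∑ i, (-(v i) * c) • ((ContinuousLinearMap.proj i : (Fin d → ℝ) →L[ℝ] ℝ).comp
          (ContinuousLinearMap.snd ℝ ℝ (Fin d → ℝ)))) z := by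
  have hl := hL.hasFDerivAt_of_hasDerivAt_prod h₁ h₂
  set T : ℝ × (Fin d → ℝ) →L[ℝ] ℝ :=
    -∑ i, v i • ((ContinuousLinearMap.proj i : (Fin d → ℝ) →L[ℝ] ℝ).comp
          (ContinuousLinearMap.snd ℝ ℝ (Fin d → ℝ))) with hT
  have hTz : ∀ z, T z = -(∑ i, z.2 i * v i) := fun z => by
    simp [hT, mul_comm]
  set A := (ContinuousLinearMap.fst ℝ ℝ (Fin d → ℝ)).prod T with hA
  have hA' : HasFDerivAt (fun z => A z) A z := A.hasFDerivAt
  have hAz : ∀ z, A z = (z.1, -(∑ i, z.2 i * v i)) := fun z => by simp [hA, hTz]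
  rw [← hAz z] at hl
  have := hl.comp z hA'
  refine (this.congr_fderiv ?_).congr_of_eventuallyEq (Filter.Eventually.of_forall fun w => ?_)
  · ext w
    · simp [hA, hT]
    · simp [hA, hT, Finset.mul_sum, Finset.sum_neg_distrib,
        mul_comm, mul_left_comm]
  · simp [hAz]

variable {Ω : Type*} [MeasurableSpace Ω] {μ : Measure Ω} {X : Ω → Fin d → ℝ}

theorem measurable_neg_inner (hX : Measurable X) (y : Fin d → ℝ) :
    Measurable fun ω => -(∑ i, y i * X ω i) := by
  have : ∀ i, Measurable fun ω => X ω i := fun i => measurable_pi_iff.1 hX i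
  fun_prop

theorem aestronglyMeasurable_fst_partial (hL : ConvexOn ℝ Set.univ (fun p : ℝ × ℝ => L p.1 p.2))
    (hX : Measurable X) (z : ℝ × (Fin d → ℝ))
    (h : ∀ᵐ ω ∂μ, HasDerivAt (fun t => L t (-(∑ i, z.2 i * X ω i)))
      (Lξ z.1 (-(∑ i, z.2 i * X ω i))) z.1) :
    AEStronglyMeasurable (fun ω => Lξ z.1 (-(∑ i, z.2 i * X ω i))) μ := by
  have hc : Continuous (fun p : ℝ × ℝ => L p.1 p.2) := hL.locallyLipschitz.continuous
  have hm : Measurable (fun p : ℝ × ℝ => deriv (fun t => L t p.1) p.2) :=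
    measurable_deriv_with_param (f := fun s t => L t s) (hc.comp continuous_swap)
  have := hm.comp ((measurable_neg_inner hX z.2).prodMk (measurable_const (a := z.1)))
  refine this.aestronglyMeasurable.congr ?_
  filter_upwards [h] with ω hω
  exact hω.deriv

theorem aestronglyMeasurable_snd_partial (hX : Measurable X) (z : ℝ × (Fin d → ℝ))
    (h : ∀ᵐ ω ∂μ, HasDerivAt (fun x => L z.1 x)
      (Lx z.1 (-(∑ i, z.2 i * X ω i))) (-(∑ i, z.2 i * X ω i))) :
    AEStronglyMeasurable (fun ω => Lx z.1 (-(∑ i, z.2 i * X ω i))) μ := by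
  have := (measurable_deriv (fun x => L z.1 x)).comp (measurable_neg_inner hX z.2)
  refine this.aestronglyMeasurable.congr ?_
  filter_upwards [h] with ω hω
  exact hω.deriv

theorem convexOn_integral_neg_inner (hL : ConvexOn ℝ Set.univ (fun p : ℝ × ℝ => L p.1 p.2))
    (hLint : ∀ (ξ : ℝ) (y : Fin d → ℝ), (∀ i, 0 ≤ y i) →
      Integrable (fun ω => L ξ (-(∑ i, y i * X ω i))) μ) :
    ConvexOn ℝ (Set.univ ×ˢ {y : Fin d → ℝ | ∀ i, 0 < y i})
      (fun z : ℝ × (Fin d → ℝ) => ∫ ω, L z.1 (-(∑ i, z.2 i * X ω i)) ∂μ) := by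
  have hconv : Convex ℝ ((Set.univ : Set ℝ) ×ˢ {y : Fin d → ℝ | ∀ i, 0 < y i}) :=
    convex_univ.prod (convex_setOf_forall_pos d)
  refine ⟨hconv, fun z hz w hw α β hα hβ hαβ => ?_⟩
  have iz := hLint z.1 z.2 fun i => (hz.2 i).le
  have iw := hLint w.1 w.2 fun i => (hw.2 i).le
  have hzw := hconv hz hw hα hβ hαβ
  rw [smul_eq_mul, smul_eq_mul, ← integral_const_mul, ← integral_const_mul,
    ← integral_add (iz.const_mul α) (iw.const_mul β)]
  refine integral_mono (hLint _ _ fun i => (hzw.2 i).le) ((iz.const_mul α).add (iw.const_mul β))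
    fun ω => ?_
  beta_reduce
  have := hL.2 (Set.mem_univ (z.1, -(∑ i, z.2 i * X ω i)))
    (Set.mem_univ (w.1, -(∑ i, w.2 i * X ω i))) hα hβ hαβ
  have e : -(∑ i, (α • z + β • w).2 i * X ω i) =
      α * -(∑ i, z.2 i * X ω i) + β * -(∑ i, w.2 i * X ω i) := by
    simp only [Prod.snd_add, Prod.smul_snd, Pi.add_apply, Pi.smul_apply, smul_eq_mul, mul_neg,
      Finset.mul_sum, ← neg_add, ← Finset.sum_add_distrib]
    exact congrArg _ (Finset.sum_congr rfl fun i _ => by ring)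
  rw [e]
  exact this

/-- Differentiation under the integral sign for `(ξ, y) ↦ E[L ξ (-⟨y, X⟩)]`. -/
theorem hasFDerivAt_integral_neg_inner
    (hX : Measurable X) (hL : ConvexOn ℝ Set.univ (fun p : ℝ × ℝ => L p.1 p.2))
    {z₀ : ℝ × (Fin d → ℝ)} {s : Set (ℝ × (Fin d → ℝ))} (hs : s ∈ nhds z₀)
    (hLint : ∀ z ∈ s, Integrable (fun ω => L z.1 (-(∑ i, z.2 i * X ω i))) μ)
    (hderiv : ∀ᵐ ω ∂μ, ∀ z ∈ s,
      HasDerivAt (fun t => L t (-(∑ i, z.2 i * X ω i))) (Lξ z.1 (-(∑ i, z.2 i * X ω i))) z.1 ∧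
      HasDerivAt (fun x => L z.1 x) (Lx z.1 (-(∑ i, z.2 i * X ω i))) (-(∑ i, z.2 i * X ω i)))
    {B : Ω → ℝ} (hB : Integrable B μ)
    (hbound : ∀ᵐ ω ∂μ, ∀ z ∈ s,
      |Lξ z.1 (-(∑ i, z.2 i * X ω i))| + ‖X ω‖ * |Lx z.1 (-(∑ i, z.2 i * X ω i))| ≤ B ω) :
    HasFDerivAt (fun z : ℝ × (Fin d → ℝ) => ∫ ω, L z.1 (-(∑ i, z.2 i * X ω i)) ∂μ)
      ((∫ ω, Lξ z₀.1 (-(∑ i, z₀.2 i * X ω i)) ∂μ) • ContinuousLinearMap.fst ℝ ℝ (Fin d → ℝ) +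
        ∑ i, (∫ ω, -(X ω i) * Lx z₀.1 (-(∑ i, z₀.2 i * X ω i)) ∂μ) •
          ((ContinuousLinearMap.proj i : (Fin d → ℝ) →L[ℝ] ℝ).comp
            (ContinuousLinearMap.snd ℝ ℝ (Fin d → ℝ)))) z₀ := by
  have hz₀ : z₀ ∈ s := mem_of_mem_nhds hs
  have hXi : ∀ i, Measurable fun ω => X ω i := fun i => measurable_pi_iff.1 hX i
  have hξm := aestronglyMeasurable_fst_partial (μ := μ) (Lξ := Lξ) hL hX z₀
    (hderiv.mono fun ω h => (h z₀ hz₀).1)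
  have hxm := aestronglyMeasurable_snd_partial (μ := μ) (Lx := Lx) hX z₀
    (hderiv.mono fun ω h => (h z₀ hz₀).2)
  have hXm : ∀ i, AEStronglyMeasurable
      (fun ω => -(X ω i) * Lx z₀.1 (-(∑ i, z₀.2 i * X ω i))) μ := fun i =>
    (hXi i).neg.aestronglyMeasurable.mul hxm
  have bξ : ∀ᵐ ω ∂μ, ∀ z ∈ s, ‖Lξ z.1 (-(∑ i, z.2 i * X ω i))‖ ≤ B ω := by
    filter_upwards [hbound] with ω h z hz
    have : 0 ≤ ‖X ω‖ * |Lx z.1 (-(∑ i, z.2 i * X ω i))| := by positivity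
    rw [Real.norm_eq_abs]
    linarith [h z hz]
  have bx : ∀ᵐ ω ∂μ, ∀ z ∈ s, ∀ i, ‖-(X ω i) * Lx z.1 (-(∑ i, z.2 i * X ω i))‖ ≤ B ω := by
    filter_upwards [hbound] with ω h z hz i
    have h₁ : |X ω i| * |Lx z.1 (-(∑ i, z.2 i * X ω i))| ≤
        ‖X ω‖ * |Lx z.1 (-(∑ i, z.2 i * X ω i))| :=
      mul_le_mul_of_nonneg_right (norm_le_pi_norm (X ω) i) (abs_nonneg _)
    rw [norm_mul, norm_neg, Real.norm_eq_abs, Real.norm_eq_abs]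
    linarith [h z hz, abs_nonneg (Lξ z.1 (-(∑ i, z.2 i * X ω i)))]
  have iξ := hB.mono' hξm (bξ.mono fun ω h => h z₀ hz₀)
  have ix := fun i => hB.mono' (hXm i) (bx.mono fun ω h => h z₀ hz₀ i)
  set P : Fin d → (ℝ × (Fin d → ℝ) →L[ℝ] ℝ) := fun i =>
    (ContinuousLinearMap.proj i : (Fin d → ℝ) →L[ℝ] ℝ).comp
      (ContinuousLinearMap.snd ℝ ℝ (Fin d → ℝ)) with hP
  set Q : ℝ × (Fin d → ℝ) →L[ℝ] ℝ := ContinuousLinearMap.fst ℝ ℝ (Fin d → ℝ) with hQ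
  have key := hasFDerivAt_integral_of_dominated_of_fderiv_le (μ := μ) (𝕜 := ℝ)
    (F := fun (z : ℝ × (Fin d → ℝ)) ω => L z.1 (-(∑ i, z.2 i * X ω i)))
    (F' := fun z ω => Lξ z.1 (-(∑ i, z.2 i * X ω i)) • Q +
      ∑ i, (-(X ω i) * Lx z.1 (-(∑ i, z.2 i * X ω i))) • P i)
    (bound := fun ω => B ω * ‖Q‖ + ∑ i, B ω * ‖P i‖) hs
    (Filter.mem_of_superset hs fun z hz => (hLint z hz).aestronglyMeasurable)
    (hLint z₀ hz₀)
    ((iξ.smul_const Q).add (integrable_finsetSum _ fun i _ =>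
      (ix i).smul_const (P i))).aestronglyMeasurable
    (by
      filter_upwards [bξ, bx] with ω h₁ h₂ z hz
      refine (norm_add_le _ _).trans (add_le_add ?_ ((norm_sum_le _ _).trans
        (Finset.sum_le_sum fun i _ => ?_)))
      · rw [norm_smul]
        exact mul_le_mul_of_nonneg_right (h₁ z hz) (norm_nonneg _)
      · rw [norm_smul]
        exact mul_le_mul_of_nonneg_right (h₂ z hz i) (norm_nonneg _))
    ((hB.mul_const _).add (integrable_finsetSum _ fun i _ => hB.mul_const _))
    (by
      filter_upwards [hderiv] with ω h z hz
      exact hasFDerivAt_neg_inner hL (X ω) z (h z hz).1 (h z hz).2)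
  rw [integral_add (iξ.smul_const Q) (integrable_finsetSum _ fun i _ =>
      (ix i).smul_const (P i)), integral_smul_const, integral_finsetSum _ fun i _ =>
      (ix i).smul_const (P i)] at key
  simpa only [integral_smul_const] using key

/-- Continuity of the integrated partial derivatives. -/
theorem continuousAt_integral_partials
    (hX : Measurable X) (hL : ConvexOn ℝ Set.univ (fun p : ℝ × ℝ => L p.1 p.2))
    {z₀ : ℝ × (Fin d → ℝ)} {s : Set (ℝ × (Fin d → ℝ))} (hs : s ∈ nhds z₀)
    (hderiv : ∀ᵐ ω ∂μ, ∀ z ∈ s,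
      HasDerivAt (fun t => L t (-(∑ i, z.2 i * X ω i))) (Lξ z.1 (-(∑ i, z.2 i * X ω i))) z.1 ∧
      HasDerivAt (fun x => L z.1 x) (Lx z.1 (-(∑ i, z.2 i * X ω i))) (-(∑ i, z.2 i * X ω i)))
    (hcont : ∀ᵐ ω ∂μ, ContinuousAt (fun p : ℝ × (Fin d → ℝ) =>
          (Lξ p.1 (-(∑ i, p.2 i * X ω i)), Lx p.1 (-(∑ i, p.2 i * X ω i)))) z₀)
    {B : Ω → ℝ} (hB : Integrable B μ)
    (hbound : ∀ᵐ ω ∂μ, ∀ z ∈ s,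
      |Lξ z.1 (-(∑ i, z.2 i * X ω i))| + ‖X ω‖ * |Lx z.1 (-(∑ i, z.2 i * X ω i))| ≤ B ω) :
    ContinuousAt (fun z : ℝ × (Fin d → ℝ) => ∫ ω, Lξ z.1 (-(∑ i, z.2 i * X ω i)) ∂μ) z₀ ∧
    ∀ j, ContinuousAt (fun z : ℝ × (Fin d → ℝ) =>
      ∫ ω, -(X ω j) * Lx z.1 (-(∑ i, z.2 i * X ω i)) ∂μ) z₀ := by
  have hXi : ∀ i, Measurable fun ω => X ω i := fun i => measurable_pi_iff.1 hX i
  refine ⟨continuousAt_of_dominated (bound := B) ?_ ?_ hB ?_,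
    fun j => continuousAt_of_dominated (bound := B) ?_ ?_ hB ?_⟩
  · filter_upwards [hs] with z hz
    exact aestronglyMeasurable_fst_partial hL hX z (hderiv.mono fun ω h => (h z hz).1)
  · filter_upwards [hs] with z hz
    filter_upwards [hbound] with ω h
    have : 0 ≤ ‖X ω‖ * |Lx z.1 (-(∑ i, z.2 i * X ω i))| := by positivity
    rw [Real.norm_eq_abs]
    linarith [h z hz]
  · filter_upwards [hcont] with ω h
    exact h.fst
  · filter_upwards [hs] with z hz
    exact (hXi j).neg.aestronglyMeasurable.mul
      (aestronglyMeasurable_snd_partial hX z (hderiv.mono fun ω h => (h z hz).2))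
  · filter_upwards [hs] with z hz
    filter_upwards [hbound] with ω h
    have h₁ : |X ω j| * |Lx z.1 (-(∑ i, z.2 i * X ω i))| ≤
        ‖X ω‖ * |Lx z.1 (-(∑ i, z.2 i * X ω i))| :=
      mul_le_mul_of_nonneg_right (norm_le_pi_norm (X ω) j) (abs_nonneg _)
    rw [norm_mul, norm_neg, Real.norm_eq_abs, Real.norm_eq_abs]
    linarith [h z hz, abs_nonneg (Lξ z.1 (-(∑ i, z.2 i * X ω i)))]
  · filter_upwards [hcont] with ω h
    exact continuousAt_const.mul h.snd

end Integrand

section RiskMeasure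

variable {d : ℕ} {b : Fin d → ℝ} {r : (Fin d → ℝ) → ℝ} {rGrad : (Fin d → ℝ) → Fin d → ℝ}
  {g : ℝ → ℝ}

theorem pos_of_homogeneous (hbsum : ∑ i, b i = 1)
    (hr_hom : ∀ c : ℝ, 0 ≤ c → ∀ y : Fin d → ℝ, (∀ i, 0 ≤ y i) → r (c • y) = c * r y)
    (hr_pos : ∀ u : Fin d → ℝ, (∀ i, 0 ≤ u i) → ∑ i, u i = 1 → 0 < r u)
    {y : Fin d → ℝ} (hy : ∀ i, 0 < y i) : 0 < ∑ i, y i ∧ 0 < r y := by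
  have hne : (Finset.univ : Finset (Fin d)).Nonempty := by
    by_contra h
    simp [Finset.not_nonempty_iff_eq_empty.1 h] at hbsum
  have hs : 0 < ∑ i, y i := Finset.sum_pos (fun i _ => hy i) hne
  refine ⟨hs, ?_⟩
  have h₁ := hr_pos ((∑ i, y i)⁻¹ • y) (fun i => mul_nonneg (inv_nonneg.2 hs.le) (hy i).le)
    (by simp [← Finset.mul_sum, hs.ne'])
  rw [hr_hom _ (inv_nonneg.2 hs.le) y fun i => (hy i).le] at h₁
  exact pos_of_mul_pos_right h₁ (inv_nonneg.2 hs.le)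

theorem strictConvexOn_comp_sub_sum_mul_log (hb : ∀ i, 0 < b i)
    (hr_hom : ∀ c : ℝ, 0 ≤ c → ∀ y : Fin d → ℝ, (∀ i, 0 ≤ y i) → r (c • y) = c * r y)
    (hr_sub : ∀ y y' : Fin d → ℝ, (∀ i, 0 ≤ y i) → (∀ i, 0 ≤ y' i) →
      r (y + y') ≤ r y + r y')
    (hr_nonneg : ∀ y : Fin d → ℝ, (∀ i, 0 < y i) → 0 ≤ r y)
    (hg_conv : ConvexOn ℝ (Ici (0 : ℝ)) g) (hg_mono : MonotoneOn g (Ici (0 : ℝ))) :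
    StrictConvexOn ℝ {y : Fin d → ℝ | ∀ i, 0 < y i}
      (fun y => g (r y) - ∑ i, b i * Real.log (y i)) := by
  have hc := convex_setOf_forall_pos d
  have hgr : ConvexOn ℝ {y : Fin d → ℝ | ∀ i, 0 < y i} (fun y => g (r y)) := by
    refine ⟨hc, fun x hx y hy α β hα hβ hαβ => ?_⟩
    have hxy := hc hx hy hα hβ hαβ
    have h₁ : r (α • x + β • y) ≤ α * r x + β * r y := by
      rw [← hr_hom α hα x fun i => (hx i).le, ← hr_hom β hβ y fun i => (hy i).le]
      exact hr_sub _ _ (fun i => mul_nonneg hα (hx i).le) (fun i => mul_nonneg hβ (hy i).le)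
    have h₀ := hr_nonneg _ hxy
    exact (hg_mono h₀ (h₀.trans h₁) h₁).trans
      (hg_conv.2 (hr_nonneg x hx) (hr_nonneg y hy) hα hβ hαβ)
  simp only [sub_eq_add_neg]
  exact hgr.add_strictConvexOn (strictConvexOn_neg_sum_mul_log hb)

theorem sum_smul_proj_apply_single (a : Fin d → ℝ) (i : Fin d) :
    (∑ j, a j • (ContinuousLinearMap.proj j : (Fin d → ℝ) →L[ℝ] ℝ)) (Pi.single i 1) = a i := by
  simp [Pi.single_apply]

/-- Euler's identity for positively homogeneous functions on the open orthant. -/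
theorem sum_mul_grad_eq_of_homogeneous
    (hr_hom : ∀ c : ℝ, 0 ≤ c → ∀ y : Fin d → ℝ, (∀ i, 0 ≤ y i) → r (c • y) = c * r y)
    {y : Fin d → ℝ} (hy : ∀ i, 0 < y i)
    (hr : HasFDerivAt r
      (∑ i, rGrad y i • (ContinuousLinearMap.proj i : (Fin d → ℝ) →L[ℝ] ℝ)) y) :
    ∑ i, y i * rGrad y i = r y := by
  have hl : HasDerivAt (fun t : ℝ => t • y) y 1 := by
    simpa using (hasDerivAt_id (1 : ℝ)).smul_const y
  have hr' : HasFDerivAt r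
      (∑ i, rGrad y i • (ContinuousLinearMap.proj i : (Fin d → ℝ) →L[ℝ] ℝ)) ((1 : ℝ) • y) := by
    simpa using hr
  have h₁ := hr'.comp_hasDerivAt (1 : ℝ) hl
  have h₂ : HasDerivAt (fun t : ℝ => t * r y) (r y) 1 := by
    simpa using (hasDerivAt_id (1 : ℝ)).mul_const (r y)
  have h₃ := h₂.congr_of_eventuallyEq (f₁ := r ∘ fun t : ℝ => t • y) (by
    filter_upwards [lt_mem_nhds (zero_lt_one : (0 : ℝ) < 1)] with t ht
    exact hr_hom t ht.le y fun i => (hy i).le)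
  have := h₁.unique h₃
  simpa [mul_comm] using this

/-- The gradient of a positively homogeneous function is invariant under scaling. -/
theorem grad_smul_eq_of_homogeneous
    (hr_diff : ∀ y : Fin d → ℝ, (∀ i, 0 < y i) →
      HasFDerivAt r (∑ i, rGrad y i • (ContinuousLinearMap.proj i : (Fin d → ℝ) →L[ℝ] ℝ)) y)
    (hr_hom : ∀ c : ℝ, 0 ≤ c → ∀ y : Fin d → ℝ, (∀ i, 0 ≤ y i) → r (c • y) = c * r y)
    {y : Fin d → ℝ} (hy : ∀ i, 0 < y i) {c : ℝ} (hc : 0 < c) :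
    rGrad (c • y) = rGrad y := by
  have hs : HasFDerivAt (fun w : Fin d → ℝ => c • w)
      (c • ContinuousLinearMap.id ℝ (Fin d → ℝ)) y := (hasFDerivAt_id y).const_smul c
  have h₁ := (hr_diff (c • y) fun i => mul_pos hc (hy i)).comp y hs
  have h₂ := ((hr_diff y hy).const_mul c).congr_of_eventuallyEq
    (f₁ := r ∘ fun w : Fin d → ℝ => c • w) (by
      filter_upwards [(isOpen_setOf_forall_pos d).mem_nhds hy] with w hw
      exact hr_hom c hc.le w fun i => (hw i).le)
  funext i
  have h₃ := DFunLike.congr_fun (h₁.unique h₂) (Pi.single i 1)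
  simp only [ContinuousLinearMap.comp_apply, smul_apply, map_smul,
    ContinuousLinearMap.id_apply, sum_smul_proj_apply_single, smul_eq_mul] at h₃
  exact mul_left_cancel₀ hc.ne' h₃

/-- A minimizer of `g ∘ r - ∑ i, b i log (y i)`, once normalized, solves the
risk-budgeting equations. -/
theorem risk_budgeting_of_isMinOn (hbsum : ∑ i, b i = 1)
    (hr_diff : ∀ y : Fin d → ℝ, (∀ i, 0 < y i) →
      HasFDerivAt r (∑ i, rGrad y i • (ContinuousLinearMap.proj i : (Fin d → ℝ) →L[ℝ] ℝ)) y)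
    (hr_hom : ∀ c : ℝ, 0 ≤ c → ∀ y : Fin d → ℝ, (∀ i, 0 ≤ y i) → r (c • y) = c * r y)
    {y : Fin d → ℝ} (hy : ∀ i, 0 < y i) {g' : ℝ} (hg : HasDerivAt g g' (r y))
    (hmin : IsMinOn (fun y => g (r y) - ∑ i, b i * Real.log (y i))
      {y : Fin d → ℝ | ∀ i, 0 < y i} y) {c : ℝ} (hc : 0 < c) (i : Fin d) :
    (c * y i) * rGrad (c • y) i = b i * r (c • y) := by
  have hd := (hg.comp_hasFDerivAt y (hr_diff y hy)).sub (hasFDerivAt_sum_mul_log b hy)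
  have hz := (hmin.isLocalMin ((isOpen_setOf_forall_pos d).mem_nhds hy)).hasFDerivAt_eq_zero hd
  have hcrit : ∀ i, g' * (y i * rGrad y i) = b i := by
    intro i
    have h := DFunLike.congr_fun hz (Pi.single i 1)
    simp only [sub_apply, smul_apply,
      sum_smul_proj_apply_single, smul_eq_mul, zero_apply] at h
    have hyi := (hy i).ne'
    field_simp at h
    linarith
  have heuler := sum_mul_grad_eq_of_homogeneous hr_hom hy (hr_diff y hy)
  have h₁ : g' * r y = 1 := by
    rw [← heuler, Finset.mul_sum, ← hbsum]
    exact Finset.sum_congr rfl fun i _ => hcrit i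
  rw [grad_smul_eq_of_homogeneous hr_diff hr_hom hy hc, hr_hom c hc.le y fun i => (hy i).le]
  linear_combination (-(c * y i * rGrad y i)) * h₁ + c * r y * hcrit i

end RiskMeasure

/-- Proposition 3.4 of the paper. Under the regularity and integrability
conditions (i)–(ii), the function `h(ξ,y) = E[L(ξ, -⟨y,X⟩)] - ∑ i, b i log (y i)` is
continuously differentiable on `ℝ × (0,∞)^d` with the stated partial derivatives, its
minimizers are exactly its critical points; moreover if for every `y` the map
`ξ ↦ E[L(ξ, -⟨y,X⟩)]` has a unique minimizer with minimal value `g(r y)`, then the `y`-part of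
any minimizer of `h` is the unique minimizer of `Γ_g`, and its normalization solves the risk
budgeting problem. -/
theorem stochastic_representation_of_RB
    {Ω : Type*} [MeasurableSpace Ω] (μ : Measure Ω) [IsProbabilityMeasure μ]
    (d : ℕ) (hd : 1 ≤ d)
    (b : Fin d → ℝ) (hb : ∀ i, 0 < b i) (hbsum : ∑ i, b i = 1)
    (X : Ω → Fin d → ℝ) (hX : Measurable X)
    (L Lξ Lx : ℝ → ℝ → ℝ)
    (hLconv : ConvexOn ℝ Set.univ (fun p : ℝ × ℝ => L p.1 p.2))
    (hLint : ∀ (ξ : ℝ) (y : Fin d → ℝ), (∀ i, 0 ≤ y i) →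
      Integrable (fun ω => L ξ (-(∑ i, y i * X ω i))) μ)
    -- condition (i): a.s. joint continuous differentiability on `ℝ × (0,∞)^d`
    (hC1 : ∀ᵐ ω ∂μ,
      (∀ (ξ : ℝ) (y : Fin d → ℝ), (∀ i, 0 < y i) →
        HasDerivAt (fun t => L t (-(∑ i, y i * X ω i))) (Lξ ξ (-(∑ i, y i * X ω i))) ξ ∧
        HasDerivAt (fun x => L ξ x) (Lx ξ (-(∑ i, y i * X ω i))) (-(∑ i, y i * X ω i))) ∧
      ContinuousOn (fun p : ℝ × (Fin d → ℝ) =>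
          (Lξ p.1 (-(∑ i, p.2 i * X ω i)), Lx p.1 (-(∑ i, p.2 i * X ω i))))
        (Set.univ ×ˢ {y : Fin d → ℝ | ∀ i, 0 < y i}))
    -- condition (ii): local domination of the gradient on closed balls of the domain
    (hdom : ∀ (z₀ : ℝ × (Fin d → ℝ)) (R : ℝ), 0 < R →
      Metric.closedBall z₀ R ⊆ Set.univ ×ˢ {y : Fin d → ℝ | ∀ i, 0 < y i} →
      ∃ gbd : Ω → ℝ, Integrable gbd μ ∧ ∀ᵐ ω ∂μ, ∀ z ∈ Metric.closedBall z₀ R,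
        |Lξ z.1 (-(∑ i, z.2 i * X ω i))| + ‖X ω‖ * |Lx z.1 (-(∑ i, z.2 i * X ω i))| ≤ gbd ω)
    -- the risk measure context
    (r : (Fin d → ℝ) → ℝ) (rGrad : (Fin d → ℝ) → Fin d → ℝ)
    (g : ℝ → ℝ) (gDeriv : ℝ → ℝ)
    (hr_cont : ContinuousOn r {y : Fin d → ℝ | ∀ i, 0 ≤ y i})
    (hr_diff : ∀ y : Fin d → ℝ, (∀ i, 0 < y i) →
      HasFDerivAt r (∑ i, rGrad y i • (ContinuousLinearMap.proj i : (Fin d → ℝ) →L[ℝ] ℝ)) y)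
    (hrGrad_cont : ContinuousOn rGrad {y : Fin d → ℝ | ∀ i, 0 < y i})
    (hr_hom : ∀ c : ℝ, 0 ≤ c → ∀ y : Fin d → ℝ, (∀ i, 0 ≤ y i) → r (c • y) = c * r y)
    (hr_sub : ∀ y y' : Fin d → ℝ, (∀ i, 0 ≤ y i) → (∀ i, 0 ≤ y' i) →
      r (y + y') ≤ r y + r y')
    (hr_pos : ∀ u : Fin d → ℝ, (∀ i, 0 ≤ u i) → ∑ i, u i = 1 → 0 < r u)
    (hg_diff : ∀ x : ℝ, 0 ≤ x → HasDerivAt g (gDeriv x) x)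
    (hgDeriv_cont : ContinuousOn gDeriv (Ici (0 : ℝ)))
    (hg_conv : ConvexOn ℝ (Ici (0 : ℝ)) g)
    (hg_mono : StrictMonoOn g (Ici (0 : ℝ))) :
    let D : Set (ℝ × (Fin d → ℝ)) := Set.univ ×ˢ {y : Fin d → ℝ | ∀ i, 0 < y i}
    let h : ℝ × (Fin d → ℝ) → ℝ := fun z =>
      (∫ ω, L z.1 (-(∑ i, z.2 i * X ω i)) ∂μ) - ∑ i, b i * Real.log (z.2 i)
    let gradξ : ℝ × (Fin d → ℝ) → ℝ := fun z => ∫ ω, Lξ z.1 (-(∑ i, z.2 i * X ω i)) ∂μ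
    let grady : ℝ × (Fin d → ℝ) → Fin d → ℝ := fun z i =>
      (∫ ω, -(X ω i) * Lx z.1 (-(∑ i, z.2 i * X ω i)) ∂μ) - b i / z.2 i
    -- `h` is C¹ on `D` with the stated partial derivatives
    (∀ z ∈ D, HasFDerivAt h
      (gradξ z • ContinuousLinearMap.fst ℝ ℝ (Fin d → ℝ) +
        ∑ i, grady z i • ((ContinuousLinearMap.proj i : (Fin d → ℝ) →L[ℝ] ℝ).comp
          (ContinuousLinearMap.snd ℝ ℝ (Fin d → ℝ)))) z) ∧
    ContinuousOn (fun z => (gradξ z, grady z)) D ∧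
    -- the minimizers of `h` are exactly its critical points
    {z : ℝ × (Fin d → ℝ) | z ∈ D ∧ IsMinOn h D z} =
      {z : ℝ × (Fin d → ℝ) | z ∈ D ∧ gradξ z = 0 ∧ ∀ i, grady z i = 0} ∧
    -- moreover: under the Bayes-type representation of `g ∘ r`, the `y`-part of any
    -- minimizer of `h` is the unique minimizer of `Γ_g`, whose normalization solves `RB_b`
    ((∀ y : Fin d → ℝ, (∀ i, 0 < y i) →
        ∃ ξs : ℝ,
          (∀ ξ : ℝ, (∫ ω, L ξs (-(∑ i, y i * X ω i)) ∂μ) ≤ ∫ ω, L ξ (-(∑ i, y i * X ω i)) ∂μ) ∧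
          (∀ ξ' : ℝ, (∀ ξ : ℝ, (∫ ω, L ξ' (-(∑ i, y i * X ω i)) ∂μ) ≤
              ∫ ω, L ξ (-(∑ i, y i * X ω i)) ∂μ) → ξ' = ξs) ∧
          (∫ ω, L ξs (-(∑ i, y i * X ω i)) ∂μ) = g (r y)) →
      ∀ ξ0 : ℝ, ∀ y0 : Fin d → ℝ, (ξ0, y0) ∈ D → IsMinOn h D (ξ0, y0) →
        (IsMinOn (fun y => g (r y) - ∑ i, b i * Real.log (y i))
            {y : Fin d → ℝ | ∀ i, 0 < y i} y0 ∧
          (∀ y : Fin d → ℝ, (∀ i, 0 < y i) →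
            IsMinOn (fun y => g (r y) - ∑ i, b i * Real.log (y i))
              {y : Fin d → ℝ | ∀ i, 0 < y i} y → y = y0)) ∧
        (∀ i, ((∑ j, y0 j)⁻¹ * y0 i) * rGrad ((∑ j, y0 j)⁻¹ • y0) i
            = b i * r ((∑ j, y0 j)⁻¹ • y0))) := by
  intro D h gradξ grady
  have hDo : IsOpen D := isOpen_univ.prod (isOpen_setOf_forall_pos d)
  have hlocal : ∀ z ∈ D, ∃ s ∈ nhds z, s ⊆ D ∧ ∃ B : Ω → ℝ, Integrable B μ ∧
      ∀ᵐ ω ∂μ, ∀ z ∈ s,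
        |Lξ z.1 (-(∑ i, z.2 i * X ω i))| + ‖X ω‖ * |Lx z.1 (-(∑ i, z.2 i * X ω i))| ≤ B ω := by
    intro z hz
    obtain ⟨R, hR, hRD⟩ := Metric.nhds_basis_closedBall.mem_iff.1 (hDo.mem_nhds hz)
    exact ⟨_, Metric.closedBall_mem_nhds z hR, hRD, hdom z R hR hRD⟩
  have hderiv : ∀ s ⊆ D, ∀ᵐ ω ∂μ, ∀ z ∈ s,
      HasDerivAt (fun t => L t (-(∑ i, z.2 i * X ω i))) (Lξ z.1 (-(∑ i, z.2 i * X ω i))) z.1 ∧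
      HasDerivAt (fun x => L z.1 x) (Lx z.1 (-(∑ i, z.2 i * X ω i)))
        (-(∑ i, z.2 i * X ω i)) := by
    intro s hs
    filter_upwards [hC1] with ω hω z hz
    exact hω.1 z.1 z.2 (hs hz).2
  have hfd : ∀ z ∈ D, HasFDerivAt h
      (gradξ z • ContinuousLinearMap.fst ℝ ℝ (Fin d → ℝ) +
        ∑ i, grady z i • ((ContinuousLinearMap.proj i : (Fin d → ℝ) →L[ℝ] ℝ).comp
          (ContinuousLinearMap.snd ℝ ℝ (Fin d → ℝ)))) z := by
    intro z hz
    obtain ⟨s, hs, hsD, B, hB, hbd⟩ := hlocal z hz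
    have h₁ := hasFDerivAt_integral_neg_inner hX hLconv hs
      (fun w hw => hLint w.1 w.2 fun i => ((hsD hw).2 i).le) (hderiv s hsD) hB hbd
    have h₂ := (hasFDerivAt_sum_mul_log b hz.2).comp z
      (ContinuousLinearMap.snd ℝ ℝ (Fin d → ℝ)).hasFDerivAt
    refine (h₁.sub h₂).congr_fderiv ?_
    rw [ContinuousLinearMap.finsetSum_comp, add_sub_assoc, ← Finset.sum_sub_distrib]
    exact congrArg _ (Finset.sum_congr rfl fun i _ => (sub_smul _ _ _).symm)
  have hcont : ContinuousOn (fun z => (gradξ z, grady z)) D := by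
    intro z hz
    obtain ⟨s, hs, hsD, B, hB, hbd⟩ := hlocal z hz
    have hc : ∀ᵐ ω ∂μ, ContinuousAt (fun p : ℝ × (Fin d → ℝ) =>
        (Lξ p.1 (-(∑ i, p.2 i * X ω i)), Lx p.1 (-(∑ i, p.2 i * X ω i)))) z := by
      filter_upwards [hC1] with ω hω
      exact hω.2.continuousAt (hDo.mem_nhds hz)
    obtain ⟨c₁, c₂⟩ := continuousAt_integral_partials hX hLconv hs (hderiv s hsD) hc hB hbd
    refine (c₁.prodMk (continuousAt_pi.2 fun i => (c₂ i).sub ?_)).continuousWithinAt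
    exact continuousAt_const.div (by fun_prop) (hz.2 i).ne'
  have hconv : ConvexOn ℝ D h := by
    have h₁ := convexOn_integral_neg_inner hLconv hLint
    have h₂ := (strictConvexOn_neg_sum_mul_log hb).convexOn.comp_linearMap
      (LinearMap.snd ℝ ℝ (Fin d → ℝ))
    have h₃ := h₁.add (h₂.subset (fun z hz => hz.2) h₁.1)
    simp only [h, sub_eq_add_neg]
    exact h₃
  refine ⟨hfd, hcont, ?_, ?_⟩
  · ext z
    refine and_congr_right fun hz => ⟨fun hmin => ?_, fun ⟨h₁, h₂⟩ => ?_⟩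
    · have h₀ := (hmin.isLocalMin (hDo.mem_nhds hz)).hasFDerivAt_eq_zero (hfd z hz)
      refine ⟨?_, fun i => ?_⟩
      · simpa using DFunLike.congr_fun h₀ (1, 0)
      · simpa [Pi.single_apply] using
          DFunLike.congr_fun h₀ (0, Pi.single i 1)
    · refine hconv.isMinOn_of_hasFDerivAt_zero hz ?_
      simpa [h₁, h₂] using hfd z hz
  · intro hrep ξ0 y0 hz0 hmin
    have hpos := fun (y : Fin d → ℝ) (hy : ∀ i, 0 < y i) =>
      pos_of_homogeneous hbsum hr_hom hr_pos hy
    have hΓ := strictConvexOn_comp_sub_sum_mul_log hb hr_hom hr_sub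
      (fun y hy => (hpos y hy).2.le) hg_conv hg_mono.monotoneOn
    have hminΓ : IsMinOn (fun y => g (r y) - ∑ i, b i * Real.log (y i))
        {y : Fin d → ℝ | ∀ i, 0 < y i} y0 := by
      refine isMinOn_iff.2 fun y hy => ?_
      obtain ⟨ξ₁, hξ₁, -, e₁⟩ := hrep y0 hz0.2
      obtain ⟨ξ₂, -, -, e₂⟩ := hrep y hy
      have h₁ := hξ₁ ξ0
      have h₂ : h (ξ0, y0) ≤ h (ξ₂, y) := isMinOn_iff.1 hmin (ξ₂, y) ⟨trivial, hy⟩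
      simp only [h] at h₂
      linarith
    refine ⟨⟨hminΓ, fun y hy hy' => hΓ.eq_of_isMinOn hy' hminΓ hy hz0.2⟩, fun i => ?_⟩
    exact risk_budgeting_of_isMinOn hbsum hr_diff hr_hom hz0.2
      (hg_diff _ (hpos y0 hz0.2).2.le) hminΓ (inv_pos.2 (hpos y0 hz0.2).1) i

end
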